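/- Let X be a finite connected (k+1)-regular graph with k ≥ 2 (every vertex has valency k+1). Let ℓ be a normalized length function on X (so Σ_{e∈E} ℓ(e) = 2), let h > 0, and suppose there is a vector (x_e)_{e∈E} with all entries positive satisfying x_e = Σ_{f∈E} ρ_{ef} e^{−h ℓ(f)} x_f for all e ∈ E. Then h ≥ (|E|/2) log k, where |E| is the number of oriented edges, and equality holds if and only if ℓ(e) = 2/|E| for every e ∈ E. -/

import Mathlib

/-- A finite graph in the sense of Serre: oriented edges with a fixed-point-free
involution `bar`, and initial/terminal vertex maps `i`, `t`. -/
structure SerreGraph (V E : Type) where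
  bar : E → E
  bar_bar : ∀ e, bar (bar e) = e
  bar_ne : ∀ e, bar e ≠ e
  i : E → V
  t : E → V
  i_bar : ∀ e, i (bar e) = t e
  t_bar : ∀ e, t (bar e) = i e

namespace SerreGraph

variable {V E : Type}

/-- `rho G e f = 1` iff `ef` is a combinatorial path without backtracking. -/
def rho [DecidableEq V] [DecidableEq E] (G : SerreGraph V E) (e f : E) : ℝ :=
  if G.t e = G.i f ∧ G.bar e ≠ f then 1 else 0

/-- The edge adjacency matrix of the graph. -/
def adjMatrix [DecidableEq V] [DecidableEq E] (G : SerreGraph V E) : Matrix E E ℝ :=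
  fun e f => G.rho e f

/-- The valency of a vertex: the number of edges with initial vertex `x`. -/
noncomputable def valency (G : SerreGraph V E) (x : V) : ℕ :=
  Nat.card {e : E // G.i e = x}

/-- `G.k x` is the valency of `x` minus one. -/
noncomputable def k (G : SerreGraph V E) (x : V) : ℕ :=
  G.valency x - 1

/-- The graph is connected: the equivalence relation on vertices generated by
relating `i e` to `t e` has a single class. -/
def Connected (G : SerreGraph V E) : Prop :=
  ∀ x y : V, Relation.EqvGen (fun a b => ∃ e : E, G.i e = a ∧ G.t e = b) x y

/-- A nonnegative square matrix is reducible if the index set splits into two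
nonempty complementary subsets with all entries between them vanishing. -/
def MatReducible (M : Matrix E E ℝ) : Prop :=
  ∃ U : Set E, U.Nonempty ∧ Uᶜ.Nonempty ∧ ∀ u ∈ U, ∀ v ∈ Uᶜ, M u v = 0 ∧ M v u = 0

/-- A matrix is irreducible if it is not reducible. -/
def MatIrreducible (M : Matrix E E ℝ) : Prop :=
  ¬ MatReducible M

/-- A length function: positive and invariant under the edge involution. -/
def IsLengthFunction (G : SerreGraph V E) (ℓ : E → ℝ) : Prop :=
  (∀ e, 0 < ℓ e) ∧ ∀ e, ℓ (G.bar e) = ℓ e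

end SerreGraph

namespace SerreGraph

variable {V E : Type}

/-- The gap `s - 1 - log s` in the tangent line inequality for the logarithm, at
`s = exp (-h ℓ(f)) x_f / (x_e / k)`. -/
noncomputable def jensenGap (k : ℕ) (ℓ : E → ℝ) (h : ℝ) (x : E → ℝ) (e f : E) : ℝ :=
  Real.exp (-h * ℓ f) * x f / (x e / k) - 1 - Real.log (Real.exp (-h * ℓ f) * x f / (x e / k))

theorem jensenGap_nonneg {k : ℕ} (hk : 0 < k) (ℓ : E → ℝ) (h : ℝ) {x : E → ℝ}
    (hx : ∀ e, 0 < x e) (e f : E) : 0 ≤ jensenGap k ℓ h x e f := by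
  have hk' : (0 : ℝ) < k := by exact_mod_cast hk
  have := hx e
  have := hx f
  have := Real.log_le_sub_one_of_pos
    (show 0 < Real.exp (-h * ℓ f) * x f / (x e / k) by positivity)
  unfold jensenGap
  linarith

theorem eq_of_jensenGap_eq_zero {k : ℕ} (hk : 0 < k) {ℓ : E → ℝ} {h : ℝ} {x : E → ℝ}
    (hx : ∀ e, 0 < x e) {e f : E} (hgap : jensenGap k ℓ h x e f = 0) :
    Real.exp (-h * ℓ f) * x f = x e / k := by
  have hk' : (0 : ℝ) < k := by exact_mod_cast hk
  have := hx e
  have := hx f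
  by_contra hne
  have hlt := Real.log_lt_sub_one_of_pos
    (show 0 < Real.exp (-h * ℓ f) * x f / (x e / k) by positivity)
    (fun h1 => hne ((div_eq_one_iff_eq (by positivity)).1 h1))
  unfold jensenGap at hgap
  linarith

variable [DecidableEq V] [DecidableEq E]

theorem rho_bar (G : SerreGraph V E) (e f : E) : G.rho (G.bar f) (G.bar e) = G.rho e f := by
  have h1 : G.bar (G.bar f) ≠ G.bar e ↔ G.bar e ≠ f := by rw [G.bar_bar, ne_comm]
  simp only [rho, G.t_bar, G.i_bar, h1, eq_comm (a := G.i f)]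

theorem rho_nonneg (G : SerreGraph V E) (e f : E) : 0 ≤ G.rho e f := by
  unfold rho
  split_ifs <;> norm_num

variable [Fintype E]

/-- The edges `f` such that `ef` is a path without backtracking. -/
def successors (G : SerreGraph V E) (e : E) : Finset E :=
  {f | G.t e = G.i f ∧ G.bar e ≠ f}

theorem mem_successors (G : SerreGraph V E) (e f : E) :
    f ∈ G.successors e ↔ G.t e = G.i f ∧ G.bar e ≠ f := by
  simp [successors]

theorem card_successors (G : SerreGraph V E) {k : ℕ} (hreg : ∀ x, G.valency x = k + 1) (e : E) :
    (G.successors e).card = k := by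
  have h1 : G.successors e = ({f | G.i f = G.t e} : Finset E).erase (G.bar e) := by
    ext f
    simp only [mem_successors, Finset.mem_erase, Finset.mem_filter, Finset.mem_univ, true_and]
    grind
  have h2 : ({f | G.i f = G.t e} : Finset E).card = k + 1 := by
    rw [← hreg (G.t e), valency, Nat.card_eq_fintype_card, Fintype.card_subtype]
  rw [h1, Finset.card_erase_of_mem (by simp [G.i_bar]), h2, Nat.add_sub_cancel]

theorem rho_eq_one (G : SerreGraph V E) {e f : E} (hf : f ∈ G.successors e) : G.rho e f = 1 :=
  if_pos ((G.mem_successors e f).1 hf)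

theorem sum_rho_right (G : SerreGraph V E) {k : ℕ} (hreg : ∀ x, G.valency x = k + 1) (e : E) :
    ∑ f, G.rho e f = k := by
  simp only [rho, Finset.sum_boole]
  exact congrArg Nat.cast (G.card_successors hreg e)

theorem sum_rho_left (G : SerreGraph V E) {k : ℕ} (hreg : ∀ x, G.valency x = k + 1) (f : E) :
    ∑ e, G.rho e f = k := by
  rw [← G.sum_rho_right hreg (G.bar f)]
  refine Fintype.sum_bijective G.bar (Function.Involutive.bijective G.bar_bar) _ _ fun e => ?_
  rw [G.rho_bar]

theorem sum_rho_mul_jensenGap (G : SerreGraph V E) {k : ℕ} (hk : 0 < k)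
    (hreg : ∀ x, G.valency x = k + 1) {ℓ : E → ℝ} {h : ℝ} {x : E → ℝ} (hx : ∀ e, 0 < x e)
    (hsys : ∀ e, x e = ∑ f, G.rho e f * Real.exp (-h * ℓ f) * x f) :
    ∑ e, ∑ f, G.rho e f * jensenGap k ℓ h x e f
      = k * (h * ∑ e, ℓ e - Fintype.card E * Real.log k) := by
  have hk' : (0 : ℝ) < k := by exact_mod_cast hk
  have expand (e f : E) : G.rho e f * jensenGap k ℓ h x e f
      = G.rho e f * Real.exp (-h * ℓ f) * x f * (k / x e)
        + G.rho e f * (Real.log (x e) - Real.log k - 1)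
        + G.rho e f * (h * ℓ f - Real.log (x f)) := by
    have he := hx e
    have hf := hx f
    rw [jensenGap, Real.log_div (by positivity) (by positivity),
      Real.log_mul (by positivity) hf.ne', Real.log_exp, Real.log_div he.ne' hk'.ne']
    field_simp
    ring
  have row (e : E) : ∑ f, G.rho e f * jensenGap k ℓ h x e f
      = k * (Real.log (x e) - Real.log k)
        + ∑ f, G.rho e f * (h * ℓ f - Real.log (x f)) := by
    simp only [expand, Finset.sum_add_distrib]
    rw [← Finset.sum_mul, ← Finset.sum_mul, ← hsys e, G.sum_rho_right hreg]
    have := (hx e).ne'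
    field_simp
    ring
  simp only [row, Finset.sum_add_distrib]
  rw [Finset.sum_comm (f := fun e f => G.rho e f * (h * ℓ f - Real.log (x f)))]
  simp only [← Finset.sum_mul, G.sum_rho_left hreg]
  simp only [← Finset.mul_sum, Finset.sum_sub_distrib, Finset.sum_const, Finset.card_univ,
    nsmul_eq_mul]
  ring

/-- If the entropy system holds termwise, all edges have length `log k / h`. -/
theorem mul_length_eq_log (G : SerreGraph V E) {k : ℕ} (hk : 2 ≤ k)
    (hreg : ∀ x, G.valency x = k + 1) {ℓ : E → ℝ} (hℓ : ∀ e, ℓ (G.bar e) = ℓ e)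
    {h : ℝ} {x : E → ℝ} (hx : ∀ e, 0 < x e)
    (hterm : ∀ e, ∀ f ∈ G.successors e, Real.exp (-h * ℓ f) * x f = x e / k) (e : E) :
    h * ℓ e = Real.log k := by
  have hk' : (0 : ℝ) < k := by exact_mod_cast (by omega : 0 < k)
  have back (e : E) : Real.exp (-h * ℓ e) * x (G.bar e) = x e / k := by
    obtain ⟨f, hf, g, hg, hfg⟩ := Finset.one_lt_card.1
      (show 1 < (G.successors e).card by rw [G.card_successors hreg]; omega)
    have hf' := (G.mem_successors e f).1 hf
    have hg' := (G.mem_successors e g).1 hg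
    have h1 := hterm (G.bar g) f ((G.mem_successors _ _).2
      ⟨by rw [G.t_bar, ← hg'.1, hf'.1], by rw [G.bar_bar]; exact hfg.symm⟩)
    have h2 := hterm (G.bar g) (G.bar e) ((G.mem_successors _ _).2
      ⟨by rw [G.t_bar, G.i_bar, hg'.1], by rw [G.bar_bar]; exact hg'.2.symm⟩)
    rw [hℓ] at h2
    rw [h2, ← h1, hterm e f hf]
  have h1 := back e
  have h2 := back (G.bar e)
  rw [G.bar_bar, hℓ] at h2
  have he := hx e
  set q := Real.exp (-h * ℓ e) with hq
  have hqpos : 0 < q := Real.exp_pos _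
  have hqk : (q * k) ^ 2 = 1 := by
    have h3 : q * k * x (G.bar e) = x e := by rw [eq_div_iff hk'.ne'] at h1; linarith
    have h4 : q * k * x e = x (G.bar e) := by rw [eq_div_iff hk'.ne'] at h2; linarith
    apply mul_right_cancel₀ he.ne'
    rw [sq, mul_assoc, h4, h3, one_mul]
  have hqk1 : q * k = 1 := (pow_eq_one_iff_of_nonneg (by positivity) two_ne_zero).1 hqk
  have hlog := congrArg Real.log hqk1
  rw [Real.log_mul hqpos.ne' hk'.ne', hq, Real.log_exp, Real.log_one] at hlog
  linarith

/-- For a constant length function the entropy is `log k` divided by the length. -/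
theorem mul_const_length_eq_log [Nonempty E] (G : SerreGraph V E) {k : ℕ} (hk : 0 < k)
    (hreg : ∀ x, G.valency x = k + 1) {c h : ℝ} {x : E → ℝ} (hx : ∀ e, 0 < x e)
    (hsys : ∀ e, x e = ∑ f, G.rho e f * Real.exp (-h * c) * x f) :
    h * c = Real.log k := by
  have hk' : (0 : ℝ) < k := by exact_mod_cast hk
  have hsum : 0 < ∑ e, x e := Finset.sum_pos (fun e _ => hx e) Finset.univ_nonempty
  have htotal : ∑ e, x e = k * Real.exp (-h * c) * ∑ e, x e := by
    conv_lhs => rw [Finset.sum_congr rfl fun e _ => hsys e, Finset.sum_comm]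
    simp only [← Finset.sum_mul, G.sum_rho_left hreg, ← Finset.mul_sum]
  have hone : k * Real.exp (-h * c) = 1 := by
    apply mul_right_cancel₀ hsum.ne'
    rw [← htotal, one_mul]
  have hlog := congrArg Real.log hone
  rw [Real.log_mul hk'.ne' (Real.exp_pos _).ne', Real.log_exp, Real.log_one] at hlog
  linarith

end SerreGraph

open SerreGraph in
/-- Regular case: for a finite connected `(k+1)`-regular graph with `k ≥ 2`, any
`h > 0` solving the entropy system for a normalized length function `ℓ` satisfies
`h ≥ (|E|/2) log k`, with equality iff all the edges have the same length
`2/|E|`. -/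
theorem entropy_regular
    {V E : Type} [Fintype V] [Fintype E] [DecidableEq V] [DecidableEq E]
    (G : SerreGraph V E) (hconn : G.Connected)
    (k : ℕ) (hk : 2 ≤ k)
    (hreg : ∀ x : V, G.valency x = k + 1)
    (ℓ : E → ℝ) (hℓ : G.IsLengthFunction ℓ) (hnorm : ∑ e : E, ℓ e = 2)
    (h : ℝ) (hpos : 0 < h)
    (hx : ∃ x : E → ℝ, (∀ e, 0 < x e) ∧
      ∀ e : E, x e = ∑ f : E, G.rho e f * Real.exp (-h * ℓ f) * x f) :
    h ≥ ((Fintype.card E : ℝ) / 2) * Real.log (k : ℝ) ∧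
      (h = ((Fintype.card E : ℝ) / 2) * Real.log (k : ℝ) ↔
        ∀ e : E, ℓ e = 2 / (Fintype.card E : ℝ)) := by
  obtain ⟨x, hx, hsys⟩ := hx
  have hk0 : 0 < k := by omega
  have hk' : (0 : ℝ) < k := by exact_mod_cast hk0
  have : Nonempty E := by
    by_contra hE
    rw [not_nonempty_iff] at hE
    simp at hnorm
  have hcard : (0 : ℝ) < Fintype.card E := by exact_mod_cast Fintype.card_pos
  have hgap := G.sum_rho_mul_jensenGap hk0 hreg hx hsys
  rw [hnorm] at hgap
  have hterm (e f : E) : 0 ≤ G.rho e f * jensenGap k ℓ h x e f :=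
    mul_nonneg (G.rho_nonneg e f) (jensenGap_nonneg hk0 ℓ h hx e f)
  have hrow (e : E) : 0 ≤ ∑ f, G.rho e f * jensenGap k ℓ h x e f :=
    Finset.sum_nonneg fun f _ => hterm e f
  have hnonneg := Finset.sum_nonneg fun e (_ : e ∈ Finset.univ) => hrow e
  refine ⟨?_, fun heq e => ?_, fun hconst => ?_⟩
  · rw [hgap] at hnonneg
    have := nonneg_of_mul_nonneg_right hnonneg hk'
    linarith
  · have hzero : ∑ e, ∑ f, G.rho e f * jensenGap k ℓ h x e f = 0 := by
      rw [hgap, heq]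
      ring
    have hvanish (e f : E) : G.rho e f * jensenGap k ℓ h x e f = 0 :=
      (Finset.sum_eq_zero_iff_of_nonneg fun f _ => hterm e f).1
        ((Finset.sum_eq_zero_iff_of_nonneg fun e _ => hrow e).1 hzero e (Finset.mem_univ e))
        f (Finset.mem_univ f)
    have hlen := G.mul_length_eq_log hk hreg hℓ.2 hx (fun e f hf =>
      eq_of_jensenGap_eq_zero hk0 hx (by simpa [G.rho_eq_one hf] using hvanish e f)) e
    rw [eq_div_iff hcard.ne']
    apply mul_left_cancel₀ hpos.ne'
    rw [← mul_assoc, hlen]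
    linarith
  · simp only [hconst] at hsys
    have hlen := G.mul_const_length_eq_log hk0 hreg hx hsys
    rw [← hlen]
    field_simp
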